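/- arXiv:1906.05065 — 2 statements merged into one kernel-verified Lean document; each statement's English description precedes it below -/
import Mathlib

section
/- Fix K > 0, T > 0, σ > 0 and r, δ ∈ ℝ, and define V(S, t) = C(S, σ, r, δ, K, T − t) for S > 0 and t < T, where C is the Black–Scholes call price. Then V satisfies the Black–Scholes partial differential equation: ∂V/∂t + (1/2)σ²S² ∂²V/∂S² + (r − δ)S ∂V/∂S − rV = 0 for all S > 0 and t < T. -/
open Real Filter Set

/-- Standard normal CDF. -/
noncomputable def stdNormalCDF (x : ℝ) : ℝ :=
  (Real.sqrt (2 * Real.pi))⁻¹ * ∫ t in Set.Iic x, Real.exp (-t ^ 2 / 2)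

/-- Standard normal density. -/
noncomputable def stdNormalPDF (x : ℝ) : ℝ :=
  (Real.sqrt (2 * Real.pi))⁻¹ * Real.exp (-x ^ 2 / 2)

/-- d₊ in the Black–Scholes formula. -/
noncomputable def dPlus (S σ r δ K τ : ℝ) : ℝ :=
  (Real.log (S / K) + (r - δ) * τ) / (σ * Real.sqrt τ) + σ * Real.sqrt τ / 2

/-- d₋ in the Black–Scholes formula. -/
noncomputable def dMinus (S σ r δ K τ : ℝ) : ℝ :=
  (Real.log (S / K) + (r - δ) * τ) / (σ * Real.sqrt τ) - σ * Real.sqrt τ / 2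

/-- Black–Scholes call price. -/
noncomputable def bsCall (S σ r δ K τ : ℝ) : ℝ :=
  S * Real.exp (-δ * τ) * stdNormalCDF (dPlus S σ r δ K τ)
    - K * Real.exp (-r * τ) * stdNormalCDF (dMinus S σ r δ K τ)

theorem aux_cdf (x : ℝ) : HasDerivAt stdNormalCDF (stdNormalPDF x) x := by
  have hint : MeasureTheory.Integrable (fun t : ℝ => Real.exp (-t ^ 2 / 2)) := by
    have := integrable_exp_neg_mul_sq (b := 1/2) (by norm_num)
    refine this.congr (Filter.Eventually.of_forall fun t => ?_)
    simp only; congr 1; ring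
  have hc : Continuous (fun t : ℝ => Real.exp (-t ^ 2 / 2)) := by fun_prop
  have h1 : stdNormalCDF = fun x => (Real.sqrt (2 * Real.pi))⁻¹ *
      ((∫ t in Set.Iic (0:ℝ), Real.exp (-t ^ 2 / 2)) + ∫ t in (0:ℝ)..x, Real.exp (-t ^ 2 / 2)) := by
    funext y
    unfold stdNormalCDF
    rw [← intervalIntegral.integral_Iic_sub_Iic hint.integrableOn hint.integrableOn]
    ring
  rw [h1]
  have h2 := (hc.integral_hasStrictDerivAt 0 x).hasDerivAt
  exact (h2.const_add _).const_mul _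

theorem aux_key (S σ r δ K τ : ℝ) (hS : 0 < S) (hK : 0 < K) (hσ : 0 < σ) (hτ : 0 < τ) :
    K * Real.exp (-r * τ) * stdNormalPDF (dMinus S σ r δ K τ)
      = S * Real.exp (-δ * τ) * stdNormalPDF (dPlus S σ r δ K τ) := by
  have hs : 0 < Real.sqrt τ := Real.sqrt_pos.2 hτ
  have hsq : Real.sqrt τ ^ 2 = τ := Real.sq_sqrt hτ.le
  have hSK : S = K * Real.exp (Real.log (S / K)) := by
    rw [Real.exp_log (by positivity)]; field_simp
  have e : -r * τ + -(dMinus S σ r δ K τ) ^ 2 / 2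
      = Real.log (S / K) + (-δ * τ + -(dPlus S σ r δ K τ) ^ 2 / 2) := by
    unfold dMinus dPlus
    generalize Real.log (S / K) = L
    generalize Real.sqrt τ = s at *
    subst hsq
    field_simp
    ring
  have e2 := congrArg Real.exp e
  rw [Real.exp_add, Real.exp_add, Real.exp_add] at e2
  unfold stdNormalPDF
  have h3 : S * Real.exp (-δ * τ) = K * Real.exp (Real.log (S / K)) * Real.exp (-δ * τ) := by
    rw [← hSK]
  rw [h3]
  linear_combination (K * (Real.sqrt (2 * Real.pi))⁻¹) * e2

theorem aux_dS (S σ r δ K τ : ℝ) (hS : 0 < S) (hK : 0 < K) (hσ : 0 < σ) (hτ : 0 < τ) :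
    HasDerivAt (fun x => (Real.log (x / K) + (r - δ) * τ) / (σ * Real.sqrt τ))
      (1 / (S * (σ * Real.sqrt τ))) S := by
  have hs : 0 < Real.sqrt τ := Real.sqrt_pos.2 hτ
  have h := ((((hasDerivAt_id S).div_const K).log (by simp; constructor <;> positivity)).add_const
    ((r - δ) * τ)).div_const (σ * Real.sqrt τ)
  refine HasDerivAt.congr_deriv h ?_
  simp only [id]
  field_simp

theorem aux_VS (S σ r δ K τ : ℝ) (hS : 0 < S) (hK : 0 < K) (hσ : 0 < σ) (hτ : 0 < τ) :
    HasDerivAt (fun x => bsCall x σ r δ K τ)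
      (Real.exp (-δ * τ) * stdNormalCDF (dPlus S σ r δ K τ)) S := by
  have hd := aux_dS S σ r δ K τ hS hK hσ hτ
  have hp : HasDerivAt (fun x => dPlus x σ r δ K τ) (1 / (S * (σ * Real.sqrt τ))) S :=
    hd.add_const _
  have hm : HasDerivAt (fun x => dMinus x σ r δ K τ) (1 / (S * (σ * Real.sqrt τ))) S :=
    hd.sub_const _
  have hP := (aux_cdf (dPlus S σ r δ K τ)).comp S hp
  have hM := (aux_cdf (dMinus S σ r δ K τ)).comp S hm
  have h := (((hasDerivAt_id S).mul_const (Real.exp (-δ * τ))).mul hP).sub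
    (hM.const_mul (K * Real.exp (-r * τ)))
  refine HasDerivAt.congr_deriv h ?_
  have hk := aux_key S σ r δ K τ hS hK hσ hτ
  simp only [id, Function.comp]
  linear_combination (-(1 / (S * (σ * Real.sqrt τ)))) * hk

theorem aux_VSS (S σ r δ K τ : ℝ) (hS : 0 < S) (hK : 0 < K) (hσ : 0 < σ) (hτ : 0 < τ) :
    deriv (deriv fun x => bsCall x σ r δ K τ) S =
      Real.exp (-δ * τ) * (stdNormalPDF (dPlus S σ r δ K τ) * (1 / (S * (σ * Real.sqrt τ)))) := by
  have hd := aux_dS S σ r δ K τ hS hK hσ hτ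
  have hp : HasDerivAt (fun x => dPlus x σ r δ K τ) (1 / (S * (σ * Real.sqrt τ))) S :=
    hd.add_const _
  have hP := ((aux_cdf (dPlus S σ r δ K τ)).comp S hp).const_mul (Real.exp (-δ * τ))
  rw [← hP.deriv]
  apply Filter.EventuallyEq.deriv_eq
  filter_upwards [lt_mem_nhds hS] with x hx
  exact (aux_VS x σ r δ K τ hx hK hσ hτ).deriv

theorem aux_Vt (S σ r δ K τ : ℝ) (hS : 0 < S) (hK : 0 < K) (hσ : 0 < σ) (hτ : 0 < τ) :
    HasDerivAt (fun x => bsCall S σ r δ K x)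
      (-δ * S * Real.exp (-δ * τ) * stdNormalCDF (dPlus S σ r δ K τ)
        + r * K * Real.exp (-r * τ) * stdNormalCDF (dMinus S σ r δ K τ)
        + S * Real.exp (-δ * τ) * stdNormalPDF (dPlus S σ r δ K τ) * (σ / (2 * Real.sqrt τ))) τ := by
  have hs : 0 < Real.sqrt τ := Real.sqrt_pos.2 hτ
  have hsd : HasDerivAt (fun x => Real.sqrt x) (1 / (2 * Real.sqrt τ)) τ :=
    Real.hasDerivAt_sqrt hτ.ne'
  have hd : ∃ D, HasDerivAt
      (fun x => (Real.log (S / K) + (r - δ) * x) / (σ * Real.sqrt x)) D τ :=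
    ⟨_, (((hasDerivAt_id τ).const_mul (r - δ)).const_add (Real.log (S / K))).div
      (hsd.const_mul σ) (by positivity)⟩
  obtain ⟨D, hd⟩ := hd
  have hh := (hsd.const_mul σ).div_const 2
  have hp : HasDerivAt (fun x => dPlus S σ r δ K x) _ τ := hd.add hh
  have hm : HasDerivAt (fun x => dMinus S σ r δ K x) _ τ := hd.sub hh
  have hP := (aux_cdf (dPlus S σ r δ K τ)).comp τ hp
  have hM := (aux_cdf (dMinus S σ r δ K τ)).comp τ hm
  have h := ((((hasDerivAt_id τ).const_mul (-δ)).exp.const_mul S).mul hP).sub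
    ((((hasDerivAt_id τ).const_mul (-r)).exp.const_mul K).mul hM)
  refine HasDerivAt.congr_deriv h ?_
  have hk := aux_key S σ r δ K τ hS hK hσ hτ
  simp only [id, Function.comp]
  linear_combination (-(D - σ * (1 / (2 * Real.sqrt τ)) / 2)) * hk

/-- The Black–Scholes call price, as a function `V(S,t) = C(S,σ,r,δ,K,T−t)`,
satisfies the Black–Scholes PDE for all `S > 0` and `t < T`. -/
theorem stmt_0 (K T σ r δ : ℝ) (hK : 0 < K) (hT : 0 < T) (hσ : 0 < σ) :
    ∀ S t : ℝ, 0 < S → t < T →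
      deriv (fun t' => bsCall S σ r δ K (T - t')) t
        + (1 / 2) * σ ^ 2 * S ^ 2 * deriv (deriv fun S' => bsCall S' σ r δ K (T - t)) S
        + (r - δ) * S * deriv (fun S' => bsCall S' σ r δ K (T - t)) S
        - r * bsCall S σ r δ K (T - t) = 0 := by
  intro S t hS ht
  have hτ : 0 < T - t := sub_pos.2 ht
  have h1 := (aux_Vt S σ r δ K (T - t) hS hK hσ hτ).comp t ((hasDerivAt_id t).const_sub T)
  have h1' : deriv (fun t' => bsCall S σ r δ K (T - t')) t = _ := h1.deriv
  rw [h1', aux_VSS S σ r δ K (T - t) hS hK hσ hτ, (aux_VS S σ r δ K (T - t) hS hK hσ hτ).deriv]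
  have hs : 0 < Real.sqrt (T - t) := Real.sqrt_pos.2 hτ
  unfold bsCall
  field_simp
  ring
end

section
/- For all S, K, σ > 0 and r, δ ∈ ℝ, the Black–Scholes call price converges to the call payoff as maturity goes to zero: lim_{τ → 0⁺} C(S, σ, r, δ, K, τ) = max(S − K, 0). -/
open Real Filter Set

lemma gauss_int : MeasureTheory.Integrable (fun t : ℝ => Real.exp (-t ^ 2 / 2)) := by
  have h := integrable_exp_neg_mul_sq (b := 1/2) (by norm_num)
  refine h.congr (Filter.Eventually.of_forall fun t => ?_)
  simp only
  congr 1; ring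

lemma gauss_total : ∫ t : ℝ, Real.exp (-t ^ 2 / 2) = Real.sqrt (2 * Real.pi) := by
  have h := integral_gaussian (1/2)
  have e : (fun t : ℝ => Real.exp (-t ^ 2 / 2)) = fun t => Real.exp (-(1/2) * t ^ 2) := by
    funext t; congr 1; ring
  rw [e, h]; congr 1; ring

lemma sqrt_two_pi_ne : Real.sqrt (2 * Real.pi) ≠ 0 := by positivity

lemma cdf_top : Tendsto stdNormalCDF atTop (nhds 1) := by
  have h := (MeasureTheory.aecover_Iic (μ := MeasureTheory.volume)
    (tendsto_id (α := ℝ) (x := atTop))).integral_tendsto_of_countably_generated gauss_int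
  rw [gauss_total] at h
  have := h.const_mul (Real.sqrt (2 * Real.pi))⁻¹
  rw [inv_mul_cancel₀ sqrt_two_pi_ne] at this
  exact this

lemma cdf_bot : Tendsto stdNormalCDF atBot (nhds 0) := by
  have h := (MeasureTheory.aecover_Ioi (μ := MeasureTheory.volume)
    (tendsto_id (α := ℝ) (x := atBot))).integral_tendsto_of_countably_generated gauss_int
  have h2 := (h.const_sub (∫ t : ℝ, Real.exp (-t ^ 2 / 2))).const_mul (Real.sqrt (2 * Real.pi))⁻¹
  rw [sub_self, mul_zero] at h2
  refine h2.congr fun x => ?_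
  have := intervalIntegral.integral_Iic_add_Ioi (b := x) (μ := MeasureTheory.volume)
    gauss_int.integrableOn gauss_int.integrableOn
  rw [← this, stdNormalCDF, id, add_sub_cancel_right]

lemma cdf_cont : Continuous stdNormalCDF := by
  have e : stdNormalCDF = fun x => (Real.sqrt (2 * Real.pi))⁻¹ *
      ((∫ t in Set.Iic (0:ℝ), Real.exp (-t ^ 2 / 2)) + ∫ t in (0:ℝ)..x, Real.exp (-t ^ 2 / 2)) := by
    funext x
    rw [← intervalIntegral.integral_Iic_sub_Iic gauss_int.integrableOn gauss_int.integrableOn,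
      add_sub_cancel, stdNormalCDF]
  rw [e]
  have := intervalIntegral.continuous_primitive (μ := MeasureTheory.volume)
    (fun a b => gauss_int.intervalIntegrable (a := a) (b := b)) 0
  fun_prop

lemma sqrt_lim : Tendsto Real.sqrt (nhdsWithin 0 (Set.Ioi 0)) (nhdsWithin 0 (Set.Ioi 0)) := by
  refine tendsto_nhdsWithin_iff.2 ⟨?_, ?_⟩
  · have := (Real.continuous_sqrt.tendsto 0).mono_left (nhdsWithin_le_nhds (s := Set.Ioi 0))
    simpa using this
  · filter_upwards [self_mem_nhdsWithin] with x hx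
    exact Real.sqrt_pos.2 hx

/-- common form of d₊ and d₋, `c = ±1/2`. -/
lemma d_eq (L a σ τ c : ℝ) (hσ : 0 < σ) (hτ : 0 < τ) :
    L / σ * (Real.sqrt τ)⁻¹ + (a / σ + c * σ) * Real.sqrt τ
      = (L + a * τ) / (σ * Real.sqrt τ) + c * (σ * Real.sqrt τ) := by
  have h := Real.sqrt_pos.2 hτ
  have h2 := Real.mul_self_sqrt hτ.le
  have h3 : a * τ = a * (Real.sqrt τ * Real.sqrt τ) := by rw [h2]
  rw [h3]
  field_simp
  ring

lemma small_lim (k : ℝ) :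
    Tendsto (fun τ => k * Real.sqrt τ) (nhdsWithin 0 (Set.Ioi 0)) (nhds 0) := by
  simpa using (sqrt_lim.mono_right nhdsWithin_le_nhds).const_mul k

lemma phi_lim (L a σ c : ℝ) (hσ : 0 < σ) :
    Tendsto (fun τ => stdNormalCDF ((L + a * τ) / (σ * Real.sqrt τ) + c * (σ * Real.sqrt τ)))
      (nhdsWithin 0 (Set.Ioi 0))
      (nhds (if 0 < L then 1 else if L < 0 then 0 else stdNormalCDF 0)) := by
  have hs := small_lim (a / σ + c * σ)
  have hi : Tendsto (fun τ => (Real.sqrt τ)⁻¹) (nhdsWithin 0 (Set.Ioi 0)) atTop :=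
    tendsto_inv_nhdsGT_zero.comp sqrt_lim
  have key : Tendsto (fun τ => stdNormalCDF
      (L / σ * (Real.sqrt τ)⁻¹ + (a / σ + c * σ) * Real.sqrt τ)) (nhdsWithin 0 (Set.Ioi 0))
      (nhds (if 0 < L then 1 else if L < 0 then 0 else stdNormalCDF 0)) := by
    rcases lt_trichotomy L 0 with h | h | h
    · rw [if_neg h.not_gt, if_pos h]
      exact cdf_bot.comp ((hi.const_mul_atTop_of_neg (div_neg_of_neg_of_pos h hσ)).atBot_add hs)
    · subst h
      simp only [lt_irrefl, if_false, zero_div, zero_mul, zero_add]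
      exact (cdf_cont.tendsto 0).comp hs
    · rw [if_pos h]
      exact cdf_top.comp ((hi.const_mul_atTop (div_pos h hσ)).atTop_add hs)
  refine key.congr' ?_
  filter_upwards [self_mem_nhdsWithin] with τ hτ
  rw [d_eq L a σ τ c hσ hτ]

lemma exp_lim (A k : ℝ) :
    Tendsto (fun τ => A * Real.exp (-k * τ)) (nhdsWithin 0 (Set.Ioi 0)) (nhds A) := by
  have h : Continuous (fun τ => A * Real.exp (-k * τ)) := by fun_prop
  have := (h.tendsto 0).mono_left (nhdsWithin_le_nhds (s := Set.Ioi 0))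
  simpa using this

/-- As maturity goes to zero, the Black–Scholes call price converges to the call payoff. -/
theorem stmt_1 (S K σ r δ : ℝ) (hS : 0 < S) (hK : 0 < K) (hσ : 0 < σ) :
    Filter.Tendsto (fun τ => bsCall S σ r δ K τ) (nhdsWithin 0 (Set.Ioi 0))
      (nhds (max (S - K) 0)) := by
  have h1 := phi_lim (Real.log (S / K)) (r - δ) σ (1/2) hσ
  have h2 := phi_lim (Real.log (S / K)) (r - δ) σ (-(1/2)) hσ
  have h := ((exp_lim S δ).mul h1).sub ((exp_lim K r).mul h2)
  have e : ∀ Φ, Φ = (if 0 < Real.log (S / K) then (1:ℝ) else if Real.log (S / K) < 0 then 0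
      else stdNormalCDF 0) → S * Φ - K * Φ = max (S - K) 0 := by
    rintro Φ rfl
    rw [Real.log_div hS.ne' hK.ne']
    rcases lt_trichotomy S K with h | h | h
    · have := Real.log_lt_log hS h
      rw [if_neg (by linarith), if_pos (by linarith), max_eq_right (by linarith)]; ring
    · subst h; simp
    · have := Real.log_lt_log hK h
      rw [if_pos (by linarith), max_eq_left (by linarith)]; ring
  rw [e _ rfl] at h
  refine h.congr fun τ => ?_
  rw [bsCall, dPlus, dMinus]
  congr 3
  · congr 1; ring
  · congr 1; ring
end
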